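/- Proposition 1.9 (general order k, local trivial-bundle form): Let E, F, W be real normed vector spaces, k ≥ 1, and let 𝓔 be any map assigning an element of W to each tuple (x, m₀, m₁, …, m_k) where x ∈ E and m_j ∈ ContinuousMultilinearMap ℝ (fun _ : Fin j => E) F for j ≤ k. Then a family of infinitely differentiable maps u_j : E → ContinuousMultilinearMap ℝ (fun _ : Fin j => E) F, 0 ≤ j ≤ k−1 (u_0 identified with a map E → F), is a sesquiholonomic solution — meaning that for every j < k−1 the derivative fderiv ℝ u_j x, curried in its new first argument, equals u_{j+1} x for all x, and that 𝓔(x, u_0 x, …, u_{k−1} x, B x) = 0 for all x, where B x is the continuous k-multilinear map obtained by uncurrying fderiv ℝ u_{k−1} x — if and only if there exists an infinitely differentiable s : E → F with u_j x = iteratedFDeriv ℝ j s x for all j ≤ k−1 and x, such that s solves the k-order system 𝓔(x, iteratedFDeriv ℝ 0 s x, …, iteratedFDeriv ℝ k s x) = 0 for all x. -/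

import Mathlib

/-- If `(u 0, …, u n)` is the jet prolongation of `s` up to order `n`, then appending the uncurried
derivative of `u n` yields the jet prolongation of `s` up to order `n + 1`. -/
theorem lastCases_uncurryLeft_fderiv_eq_iteratedFDeriv
    {E F : Type*} [NormedAddCommGroup E] [NormedSpace ℝ E]
    [NormedAddCommGroup F] [NormedSpace ℝ F] {n : ℕ}
    {u : ∀ j : ℕ, E → ContinuousMultilinearMap ℝ (fun _ : Fin j => E) F} {s : E → F}
    (h : ∀ j ≤ n, u j = iteratedFDeriv ℝ j s) (x : E) :
    (Fin.lastCases ((fderiv ℝ (u n) x).uncurryLeft) (fun j : Fin (n + 1) => u j x) :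
      ∀ j : Fin (n + 2), ContinuousMultilinearMap ℝ (fun _ : Fin (j : ℕ) => E) F) =
    fun j : Fin (n + 2) => iteratedFDeriv ℝ (j : ℕ) s x := by
  funext j
  induction j using Fin.lastCases with
  | last =>
    rw [Fin.lastCases_last, h n le_rfl]
    rfl
  | cast j =>
    rw [Fin.lastCases_castSucc, h j (Nat.le_of_lt_succ j.isLt)]
    rfl

/-- A family whose successive derivatives are its successive members, up to order `n`, is the
jet prolongation of its zeroth member. -/
theorem eq_iteratedFDeriv_of_fderiv_eq
    {E F : Type*} [NormedAddCommGroup E] [NormedSpace ℝ E]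
    [NormedAddCommGroup F] [NormedSpace ℝ F] {n : ℕ}
    {u : ∀ j : ℕ, E → ContinuousMultilinearMap ℝ (fun _ : Fin j => E) F}
    (h : ∀ j < n, ∀ (x v : E) (m : Fin j → E),
      fderiv ℝ (u j) x v m = u (j + 1) x (Fin.cons v m)) :
    ∀ j ≤ n, u j = iteratedFDeriv ℝ j (fun x => u 0 x 0) := by
  intro j
  induction j with
  | zero =>
    intro _
    ext x m
    rw [iteratedFDeriv_zero_apply, Subsingleton.elim m 0]
  | succ j ih =>
    intro hj
    ext x m
    rw [iteratedFDeriv_succ_apply_left, ← ih (by omega), h j hj, Fin.cons_self_tail]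


/-- Proposition 1.9 (general order `k = n + 1 ≥ 1`, local trivial-bundle form):
a family `(u 0, …, u n)` of smooth jet-coordinate maps is a sesquiholonomic
solution of the first-order system associated with the `k`-order differential
operator `𝓔` if and only if it is the `(k-1)`-order jet prolongation of a
smooth section `s` solving the `k`-order system defined by `𝓔`. -/
theorem prop_1_9_order_k
    {E F W : Type*} [NormedAddCommGroup E] [NormedSpace ℝ E]
    [NormedAddCommGroup F] [NormedSpace ℝ F] [NormedAddCommGroup W] [NormedSpace ℝ W]
    (n : ℕ)
    (𝓔 : E → (∀ j : Fin (n + 2), ContinuousMultilinearMap ℝ (fun _ : Fin (j : ℕ) => E) F) → W)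
    (u : ∀ j : ℕ, E → ContinuousMultilinearMap ℝ (fun _ : Fin j => E) F)
    (hu : ∀ j ≤ n, ContDiff ℝ (⊤ : ℕ∞) (u j)) :
    (((∀ j < n, ∀ (x v : E) (m : Fin j → E),
        fderiv ℝ (u j) x v m = u (j + 1) x (Fin.cons v m)) ∧
      (∀ x : E, 𝓔 x
        (Fin.lastCases ((fderiv ℝ (u n) x).uncurryLeft) (fun j : Fin (n + 1) => u j x)) = 0))
      ↔
    (∃ s : E → F, ContDiff ℝ (⊤ : ℕ∞) s ∧
      (∀ j ≤ n, ∀ x : E, u j x = iteratedFDeriv ℝ j s x) ∧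
      (∀ x : E, 𝓔 x (fun j : Fin (n + 2) => iteratedFDeriv ℝ (j : ℕ) s x) = 0))) := by
  constructor
  · rintro ⟨hder, hsol⟩
    have hjet := eq_iteratedFDeriv_of_fderiv_eq hder
    refine ⟨fun x => u 0 x 0, ?_, fun j hj x => congrFun (hjet j hj) x, fun x => ?_⟩
    · exact (ContinuousMultilinearMap.apply ℝ (fun _ : Fin 0 => E) F 0).contDiff.comp
        (hu 0 n.zero_le)
    · rw [← lastCases_uncurryLeft_fderiv_eq_iteratedFDeriv hjet x]
      exact hsol x
  · rintro ⟨s, -, hs, hsol⟩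
    have hjet : ∀ j ≤ n, u j = iteratedFDeriv ℝ j s := fun j hj => funext (hs j hj)
    refine ⟨fun j hj x v m => ?_, fun x => ?_⟩
    · rw [hjet j hj.le, hjet (j + 1) hj, iteratedFDeriv_succ_apply_left, Fin.cons_zero,
        Fin.tail_cons]
    · rw [lastCases_uncurryLeft_fderiv_eq_iteratedFDeriv hjet x]
      exact hsol x
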